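/- (Completing the square for the full conditional of vec(G).) Let Σ be a symmetric positive definite n×n real matrix, Ω a symmetric positive definite T×T matrix, X an n×T matrix, B̃ an n×R̃ matrix, B̃_m an n×R̃_m matrix, V a symmetric positive definite (R̃·R̃_m)×(R̃·R̃_m) matrix, g₀ ∈ ℝ^{R̃·R̃_m}, and Y, A n×T matrices. Define K_g = V⁻¹ + (B̃ᵀXΩ⁻¹XᵀB̃)⊗(B̃_mᵀΣ⁻¹B̃_m) and ĝ = K_g⁻¹·(V⁻¹g₀ + vec(B̃_mᵀ·Σ⁻¹·(Y−A)·Ω⁻¹·Xᵀ·B̃)). Then K_g is symmetric positive definite, and there exists c ∈ ℝ such that for every R̃_m×R̃ matrix G̃, with g = vec(G̃): tr( Ω⁻¹·(Y − A − B̃_m·G̃·B̃ᵀ·X)ᵀ·Σ⁻¹·(Y − A − B̃_m·G̃·B̃ᵀ·X) ) + (g − g₀)ᵀ·V⁻¹·(g − g₀) = (g − ĝ)ᵀ·K_g·(g − ĝ) + c. -/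

import Mathlib

open Matrix
open scoped Kronecker

theorem quad_sub_aux {ι : Type*} [Fintype ι] (K : Matrix ι ι ℝ) (hK : Kᵀ = K) (g h : ι → ℝ) :
    (g - h) ⬝ᵥ K *ᵥ (g - h) = g ⬝ᵥ K *ᵥ g - 2 * (g ⬝ᵥ K *ᵥ h) + h ⬝ᵥ K *ᵥ h := by
  have e : h ⬝ᵥ K *ᵥ g = g ⬝ᵥ K *ᵥ h := by
    rw [dotProduct_mulVec, ← mulVec_transpose, hK, dotProduct_comm]
  rw [mulVec_sub, sub_dotProduct, dotProduct_sub, dotProduct_sub, e]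
  ring

theorem trace_sub_aux {n T : ℕ} (W : Matrix (Fin T) (Fin T) ℝ) (hW : Wᵀ = W)
    (P : Matrix (Fin n) (Fin n) ℝ) (hP : Pᵀ = P) (D M : Matrix (Fin n) (Fin T) ℝ) :
    trace (W * (D - M)ᵀ * P * (D - M)) =
      trace (W * Dᵀ * P * D) - 2 * trace (W * Mᵀ * P * D) + trace (W * Mᵀ * P * M) := by
  have e : trace (W * Dᵀ * P * M) = trace (W * Mᵀ * P * D) := by
    rw [← trace_transpose]
    simp only [transpose_mul, transpose_transpose, hW, hP]
    rw [← Matrix.mul_assoc, ← Matrix.mul_assoc, trace_mul_comm]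
    simp only [Matrix.mul_assoc]
  simp only [transpose_sub, Matrix.mul_sub, Matrix.sub_mul, trace_sub, e]
  ring

/-- Completing the square for the full conditional of `vec(G̃)`. -/
theorem complete_square_vecG {n T Rt Rm : ℕ}
    (S : Matrix (Fin n) (Fin n) ℝ) (hS : S.PosDef)
    (Ω : Matrix (Fin T) (Fin T) ℝ) (hΩ : Ω.PosDef)
    (X : Matrix (Fin n) (Fin T) ℝ)
    (Bt : Matrix (Fin n) (Fin Rt) ℝ)   -- B̃, n×R̃
    (Bm : Matrix (Fin n) (Fin Rm) ℝ)   -- B̃_m, n×R̃_m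
    (V : Matrix (Fin Rt × Fin Rm) (Fin Rt × Fin Rm) ℝ) (hV : V.PosDef)
    (g₀ : Fin Rt × Fin Rm → ℝ)
    (Y A : Matrix (Fin n) (Fin T) ℝ)
    (Kg : Matrix (Fin Rt × Fin Rm) (Fin Rt × Fin Rm) ℝ)
    (hKg : Kg = V⁻¹ + (Btᵀ * X * Ω⁻¹ * Xᵀ * Bt) ⊗ₖ (Bmᵀ * S⁻¹ * Bm))
    (ghat : Fin Rt × Fin Rm → ℝ)
    (hghat : ghat = Kg⁻¹.mulVec (V⁻¹.mulVec g₀ +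
      -- vec(B̃_mᵀ·Σ⁻¹·(Y−A)·Ω⁻¹·Xᵀ·B̃), indexed by (r̃, r̃_m)
      (fun (p : Fin Rt × Fin Rm) => (Bmᵀ * S⁻¹ * (Y - A) * Ω⁻¹ * Xᵀ * Bt) p.2 p.1))) :
    Kg.PosDef ∧ ∃ c : ℝ, ∀ Gt : Matrix (Fin Rm) (Fin Rt) ℝ,
      Matrix.trace (Ω⁻¹ * (Y - A - Bm * Gt * Btᵀ * X)ᵀ * S⁻¹ *
          (Y - A - Bm * Gt * Btᵀ * X))
        + ((fun (p : Fin Rt × Fin Rm) => Gt p.2 p.1) - g₀) ⬝ᵥ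
            V⁻¹.mulVec ((fun (p : Fin Rt × Fin Rm) => Gt p.2 p.1) - g₀)
      = ((fun (p : Fin Rt × Fin Rm) => Gt p.2 p.1) - ghat) ⬝ᵥ
            Kg.mulVec ((fun (p : Fin Rt × Fin Rm) => Gt p.2 p.1) - ghat)
        + c := by
  have hP : (S⁻¹)ᵀ = S⁻¹ := by simpa using hS.inv.isHermitian.eq
  have hW : (Ω⁻¹)ᵀ = Ω⁻¹ := by simpa using hΩ.inv.isHermitian.eq
  have hVt : (V⁻¹)ᵀ = V⁻¹ := by simpa using hV.inv.isHermitian.eq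
  have h1 : (Btᵀ * X * Ω⁻¹ * Xᵀ * Bt).PosSemidef := by
    have := hΩ.inv.posSemidef.conjTranspose_mul_mul_same (Xᵀ * Bt)
    simpa [Matrix.mul_assoc] using this
  have h2 : (Bmᵀ * S⁻¹ * Bm).PosSemidef := by
    have := hS.inv.posSemidef.conjTranspose_mul_mul_same Bm
    simpa [Matrix.mul_assoc] using this
  have hK : Kg.PosDef := by
    rw [hKg]
    exact hV.inv.add_posSemidef (h1.kronecker h2)
  have hKt : Kgᵀ = Kg := by simpa using hK.isHermitian.eq
  have hKh : Kg *ᵥ ghat = V⁻¹ *ᵥ g₀ + vec (Bmᵀ * S⁻¹ * (Y - A) * Ω⁻¹ * Xᵀ * Bt) := by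
    rw [hghat, mulVec_mulVec, Matrix.mul_nonsing_inv _ ((Matrix.isUnit_iff_isUnit_det _).1 hK.isUnit),
      one_mulVec]
    rfl
  refine ⟨hK, trace (Ω⁻¹ * (Y - A)ᵀ * S⁻¹ * (Y - A)) + g₀ ⬝ᵥ V⁻¹ *ᵥ g₀ - ghat ⬝ᵥ Kg *ᵥ ghat, ?_⟩
  intro Gt
  change _ + (vec Gt - g₀) ⬝ᵥ V⁻¹ *ᵥ (vec Gt - g₀) = (vec Gt - ghat) ⬝ᵥ Kg *ᵥ (vec Gt - ghat) + _
  rw [trace_sub_aux _ hW _ hP, quad_sub_aux _ hVt, quad_sub_aux _ hKt]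
  have e1 : vec Gt ⬝ᵥ Kg *ᵥ ghat = vec Gt ⬝ᵥ V⁻¹ *ᵥ g₀ +
      trace (Ω⁻¹ * (Bm * Gt * Btᵀ * X)ᵀ * S⁻¹ * (Y - A)) := by
    rw [hKh, dotProduct_add, vec_dotProduct_vec]
    congr 1
    generalize Y - A = D
    have : Gtᵀ * (Bmᵀ * S⁻¹ * D * Ω⁻¹ * Xᵀ * Bt) =
      (Gtᵀ * Bmᵀ * S⁻¹ * D) * (Ω⁻¹ * Xᵀ * Bt) := by simp only [Matrix.mul_assoc]
    rw [this, trace_mul_comm]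
    simp only [transpose_mul, transpose_transpose, Matrix.mul_assoc]
  have e2 : vec Gt ⬝ᵥ Kg *ᵥ vec Gt = vec Gt ⬝ᵥ V⁻¹ *ᵥ vec Gt +
      trace (Ω⁻¹ * (Bm * Gt * Btᵀ * X)ᵀ * S⁻¹ * (Bm * Gt * Btᵀ * X)) := by
    rw [hKg, add_mulVec, dotProduct_add, kronecker_mulVec_vec, vec_dotProduct_vec]
    congr 1
    have : Gtᵀ * (Bmᵀ * S⁻¹ * Bm * Gt * (Btᵀ * X * Ω⁻¹ * Xᵀ * Bt)ᵀ) =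
      (Gtᵀ * Bmᵀ * S⁻¹ * Bm * Gt * Btᵀ * X) * (Ω⁻¹ * Xᵀ * Bt) := by
      simp only [transpose_mul, transpose_transpose, hW, Matrix.mul_assoc]
    rw [this, trace_mul_comm]
    simp only [transpose_mul, transpose_transpose, Matrix.mul_assoc]
  rw [e1, e2]
  ring
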